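/- arXiv:2207.03663 — 2 statements merged into one kernel-verified Lean document; each statement's English description precedes it below -/
import Mathlib

section
/- Let A be a finite-dimensional algebra over a field k and let f : X → M and f' : X' → M' be morphisms in mod A. If both f and f' are right minimal, then the direct sum f ⊕ f' : X ⊕ X' → M ⊕ M' is right minimal. -/
/-- A morphism `f : X → M` in `mod A` is right minimal if every endomorphism `g : X → X`
with `f ∘ g = f` is an automorphism (i.e. a bijective linear endomorphism). -/
def IsRightMinimal (A : Type) [Ring A] {X M : Type}
    [AddCommGroup X] [Module A X] [AddCommGroup M] [Module A M]
    (f : X →ₗ[A] M) : Prop :=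
  ∀ g : X →ₗ[A] X, f ∘ₗ g = f → Function.Bijective g

/-- A block endomorphism of `X × X'` is bijective if its upper left entry `e` is invertible
and the Schur complement `d - c e⁻¹ b` is bijective. -/
theorem LinearMap.bijective_of_bijective_schurComplement {R X X' : Type*} [Ring R]
    [AddCommGroup X] [Module R X] [AddCommGroup X'] [Module R X']
    (e : X ≃ₗ[R] X) (b : X' →ₗ[R] X) (c : X →ₗ[R] X') (d : X' →ₗ[R] X')
    (h : Function.Bijective (d - c ∘ₗ e.symm.toLinearMap ∘ₗ b)) :
    Function.Bijective ((e.toLinearMap.coprod b).prod (c.coprod d)) := by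
  constructor
  · rw [injective_iff_map_eq_zero]
    rintro ⟨x, y⟩ hxy
    obtain ⟨h₁, h₂⟩ : e x + b y = 0 ∧ c x + d y = 0 := by simpa using hxy
    have hx : x = -e.symm (b y) := by
      rw [← map_neg, ← eq_neg_of_add_eq_zero_left h₁, e.symm_apply_apply]
    have hy : y = 0 := (injective_iff_map_eq_zero _).1 h.1 y <| by
      rw [hx, map_neg] at h₂
      simpa [sub_eq_neg_add] using h₂
    simp [hx, hy]
  · rintro ⟨u, v⟩
    obtain ⟨y, hy⟩ := h.2 (v - c (e.symm u))
    have hy' : d y - c (e.symm (b y)) = v - c (e.symm u) := hy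
    refine ⟨(e.symm (u - b y), y), Prod.ext (by simp) ?_⟩
    change c (e.symm (u - b y)) + d y = v
    rw [map_sub, map_sub, sub_add_eq_add_sub, add_sub_assoc, hy', add_sub_cancel]

/-- Let `A` be a finite-dimensional algebra over a field `k` and let
`f : X → M` and `f' : X' → M'` be morphisms in `mod A`.  If both are right minimal, then so
is their direct sum `f ⊕ f' : X ⊕ X' → M ⊕ M'`. -/
theorem isRightMinimal_prodMap
    (k : Type) [Field k] (A : Type) [Ring A] [Algebra k A] [FiniteDimensional k A]
    (X M X' M' : Type)
    [AddCommGroup X] [Module A X] [Module.Finite A X]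
    [AddCommGroup M] [Module A M] [Module.Finite A M]
    [AddCommGroup X'] [Module A X'] [Module.Finite A X']
    [AddCommGroup M'] [Module A M'] [Module.Finite A M']
    (f : X →ₗ[A] M) (f' : X' →ₗ[A] M')
    (hf : IsRightMinimal A f) (hf' : IsRightMinimal A f') :
    IsRightMinimal A (f.prodMap f') := by
  intro g hg
  have hl (x : X) : f (g (x, 0)).1 = f x ∧ f' (g (x, 0)).2 = 0 := by
    simpa using LinearMap.congr_fun hg (x, 0)
  have hr (y : X') : f (g (0, y)).1 = 0 ∧ f' (g (0, y)).2 = f' y := by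
    simpa using LinearMap.congr_fun hg (0, y)
  let a := LinearMap.fst A X X' ∘ₗ g ∘ₗ LinearMap.inl A X X'
  let b := LinearMap.fst A X X' ∘ₗ g ∘ₗ LinearMap.inr A X X'
  let c := LinearMap.snd A X X' ∘ₗ g ∘ₗ LinearMap.inl A X X'
  let d := LinearMap.snd A X X' ∘ₗ g ∘ₗ LinearMap.inr A X X'
  let e := LinearEquiv.ofBijective a (hf a (LinearMap.ext fun x => (hl x).1))
  have hschur : Function.Bijective (d - c ∘ₗ e.symm.toLinearMap ∘ₗ b) := by
    refine hf' _ (LinearMap.ext fun y => ?_)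
    have hc (x : X) : f' (c x) = 0 := (hl x).2
    have hd : f' (d y) = f' y := (hr y).2
    simp [hc, hd]
  have hg_eq : g = (e.toLinearMap.coprod b).prod (c.coprod d) := by
    ext x <;> simp [e, a, b, c, d, Prod.mk_zero_zero]
  rw [hg_eq]
  exact LinearMap.bijective_of_bijective_schurComplement e b c d hschur
end

section
/- Let A be a finite-dimensional algebra over a field k, G a module in mod A that is both a generator and a cogenerator (i.e., every indecomposable projective and every indecomposable injective A-module lies in add G up to isomorphism), I = add G, and Λ = End_A(G). Then I-rgldim A = gldim Λ − 2. -/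
/-- A bundled module over the ring `A`. -/
structure ModOver (A : Type) [Ring A] : Type 1 where
  carrier : Type
  [acg : AddCommGroup carrier]
  [mod : Module A carrier]

attribute [instance] ModOver.acg ModOver.mod
/-- `N` belongs to `add G`: `N` is a direct summand of a finite direct sum of copies of `G`. -/
def InAdd (A : Type) [Ring A] (G : Type) [AddCommGroup G] [Module A G]
    (N : Type) [AddCommGroup N] [Module A N] : Prop :=
  ∃ (n : ℕ) (s : N →ₗ[A] (Fin n → G)) (r : (Fin n → G) →ₗ[A] N), r ∘ₗ s = LinearMap.id
/-- `f : X → M` is a right `add G`-approximation of `M`. -/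
def IsRightApprox (A : Type) [Ring A] (G : Type) [AddCommGroup G] [Module A G]
    {X M : Type} [AddCommGroup X] [Module A X] [AddCommGroup M] [Module A M]
    (f : X →ₗ[A] M) : Prop :=
  InAdd A G X ∧
  ∀ (Y : Type) [AddCommGroup Y] [Module A Y], InAdd A G Y →
    ∀ g : Y →ₗ[A] M, ∃ h : Y →ₗ[A] X, f ∘ₗ h = g
/-- The data `(X, f, f0)` is an `add G`-resolution of `M`:
`f0 : X 0 → M` is a right approximation of `M`, and for each `i`, `f i : X (i+1) → X i`
takes values in the kernel of the previous map and is (as a map into that kernel) a right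
approximation of it. -/
def IsIRes (A : Type) [Ring A] (G : Type) [AddCommGroup G] [Module A G]
    (M : Type) [AddCommGroup M] [Module A M]
    (X : ℕ → ModOver A) (f : ∀ i, (X (i + 1)).carrier →ₗ[A] (X i).carrier)
    (f0 : (X 0).carrier →ₗ[A] M) : Prop :=
  IsRightApprox A G f0 ∧
  (∀ i, InAdd A G (X (i + 1)).carrier) ∧
  (∀ x, f0 (f 0 x) = 0) ∧
  (∀ i x, f i (f (i + 1) x) = 0) ∧
  (∀ (Y : Type) [AddCommGroup Y] [Module A Y], InAdd A G Y →
    ∀ g : Y →ₗ[A] (X 0).carrier, (∀ y, f0 (g y) = 0) →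
      ∃ h : Y →ₗ[A] (X 1).carrier, ∀ y, f 0 (h y) = g y) ∧
  (∀ i, ∀ (Y : Type) [AddCommGroup Y] [Module A Y], InAdd A G Y →
    ∀ g : Y →ₗ[A] (X (i + 1)).carrier, (∀ y, f i (g y) = 0) →
      ∃ h : Y →ₗ[A] (X (i + 2)).carrier, ∀ y, f (i + 1) (h y) = g y)
/-- The `add G`-resolution dimension of `M` is at most `n`: there is an `add G`-resolution
of `M` vanishing in degrees `> n`. -/
def IRdimLE (A : Type) [Ring A] (G : Type) [AddCommGroup G] [Module A G]
    (M : Type) [AddCommGroup M] [Module A M] (n : ℕ) : Prop :=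
  ∃ (X : ℕ → ModOver A) (f : ∀ i, (X (i + 1)).carrier →ₗ[A] (X i).carrier)
    (f0 : (X 0).carrier →ₗ[A] M),
    IsIRes A G M X f f0 ∧ ∀ i, n < i → ∀ x : (X i).carrier, x = 0

/-- The endomorphism algebra `Λ = End_A(G)` with morphisms composed "from the right"
(i.e. the opposite of the usual endomorphism ring), as in the paper. -/
abbrev EndOp (A : Type) [Ring A] (G : Type) [AddCommGroup G] [Module A G] : Type :=
  (Module.End A G)ᵐᵒᵖ

/-- `Hom_A(G, M)` is a left `Λ`-module via `φ • f = f ∘ φ`. -/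
instance homModule (A : Type) [Ring A] (G : Type) [AddCommGroup G] [Module A G]
    (M : Type) [AddCommGroup M] [Module A M] :
    Module (EndOp A G) (G →ₗ[A] M) where
  smul a f := f ∘ₗ a.unop
  one_smul f := rfl
  mul_smul a b f := rfl
  smul_zero a := rfl
  smul_add a f g := rfl
  add_smul a b f := by
    show f ∘ₗ (a.unop + b.unop) = f ∘ₗ a.unop + f ∘ₗ b.unop
    ext x; simp
  zero_smul f := by
    show f ∘ₗ (0 : Module.End A G) = 0
    ext x; simp

/-- The projective dimension of the `R`-module `N` is at most `n`: there is a projective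
resolution `0 → Pₙ → ⋯ → P₀ → N → 0` by finitely generated projective `R`-modules. -/
def PdLE (R : Type) [Ring R] (N : Type) [AddCommGroup N] [Module R N] (n : ℕ) : Prop :=
  ∃ (X : ℕ → ModOver R) (f : ∀ i, (X (i + 1)).carrier →ₗ[R] (X i).carrier)
    (f0 : (X 0).carrier →ₗ[R] N),
    (∀ i, Module.Finite R (X i).carrier) ∧ (∀ i, Module.Projective R (X i).carrier) ∧
    Function.Surjective f0 ∧
    LinearMap.range (f 0) = LinearMap.ker f0 ∧
    (∀ i, LinearMap.range (f (i + 1)) = LinearMap.ker (f i)) ∧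
    (∀ i, n < i → ∀ x : (X i).carrier, x = 0)

/-- The (left) global dimension of `R` is at most `n`: every finitely generated `R`-module
has projective dimension at most `n`. -/
def GldimLE (R : Type) [Ring R] (n : ℕ) : Prop :=
  ∀ (N : Type) [AddCommGroup N] [Module R N], Module.Finite R N → PdLE R N n

/-- `N` is an indecomposable module: it is nonzero and its only idempotent endomorphisms
are `0` and the identity. -/
def IsIndecomposable (A : Type) [Ring A] (N : Type) [AddCommGroup N] [Module A N] : Prop :=
  (∃ x : N, x ≠ 0) ∧ ∀ e : N →ₗ[A] N, e ∘ₗ e = e → e = 0 ∨ e = LinearMap.id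

section AddCategory

variable {A : Type} [Ring A] {G : Type} [AddCommGroup G] [Module A G]

theorem InAdd.self : InAdd A G G :=
  ⟨1, LinearMap.pi fun _ => LinearMap.id, LinearMap.proj 0, rfl⟩

theorem InAdd.of_retract {M N : Type} [AddCommGroup M] [Module A M] [AddCommGroup N] [Module A N]
    (hM : InAdd A G M) (s : N →ₗ[A] M) (r : M →ₗ[A] N) (h : ∀ x, r (s x) = x) :
    InAdd A G N := by
  obtain ⟨n, s', r', hs⟩ := hM
  refine ⟨n, s' ∘ₗ s, r ∘ₗ r', ?_⟩
  ext x
  have : r' (s' (s x)) = s x := LinearMap.congr_fun hs (s x)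
  simp [this, h]

theorem InAdd.pi (n : ℕ) : InAdd A G (Fin n → G) :=
  ⟨n, LinearMap.id, LinearMap.id, rfl⟩

theorem InAdd.of_forall_eq_zero {N : Type} [AddCommGroup N] [Module A N]
    (h : ∀ x : N, x = 0) : InAdd A G N :=
  ⟨0, 0, 0, by ext x; exact (h x).symm⟩

theorem InAdd.prod {M N : Type} [AddCommGroup M] [Module A M] [AddCommGroup N] [Module A N]
    (hM : InAdd A G M) (hN : InAdd A G N) : InAdd A G (M × N) := by
  obtain ⟨m, s, r, hs⟩ := hM
  obtain ⟨n, s', r', hs'⟩ := hN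
  let e : (Fin (m + n) → G) ≃ₗ[A] (Fin m → G) × (Fin n → G) :=
    (LinearEquiv.funCongrLeft A G finSumFinEquiv).trans (LinearEquiv.sumArrowLequivProdArrow _ _ A G)
  refine (InAdd.pi (m + n)).of_retract (e.symm.toLinearMap ∘ₗ s.prodMap s')
    (r.prodMap r' ∘ₗ e.toLinearMap) ?_
  rintro ⟨x, y⟩
  have h₁ : r (s x) = x := LinearMap.congr_fun hs x
  have h₂ : r' (s' y) = y := LinearMap.congr_fun hs' y
  simp [h₁, h₂]

theorem InAdd.moduleFinite [Module.Finite A G] {N : Type} [AddCommGroup N] [Module A N]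
    (h : InAdd A G N) : Module.Finite A N := by
  obtain ⟨n, s, r, hs⟩ := h
  exact Module.Finite.of_surjective r fun x => ⟨s x, LinearMap.congr_fun hs x⟩

/-- An identity decomposition of a module in `add G` through maps to and from `G`. -/
theorem InAdd.exists_decomposition {N : Type} [AddCommGroup N] [Module A N] (h : InAdd A G N) :
    ∃ (n : ℕ) (p : Fin n → N →ₗ[A] G) (q : Fin n → G →ₗ[A] N), ∀ x, ∑ i, q i (p i x) = x := by
  obtain ⟨n, s, r, hs⟩ := h
  refine ⟨n, fun i => LinearMap.proj i ∘ₗ s, fun i => r ∘ₗ LinearMap.single A (fun _ => G) i,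
    fun x => ?_⟩
  have h₁ : r (s x) = x := LinearMap.congr_fun hs x
  conv_rhs => rw [← h₁, ← Finset.univ_sum_single (s x), map_sum]
  rfl

/-- If `A` is in `add G`, then maps out of `G` generate every module. -/
theorem InAdd.exists_sum_eq (hgen : InAdd A G A) {N : Type} [AddCommGroup N] [Module A N] (x : N) :
    ∃ (n : ℕ) (q : Fin n → G →ₗ[A] N) (y : Fin n → G), ∑ i, q i (y i) = x := by
  obtain ⟨n, p, q, h⟩ := hgen.exists_decomposition
  refine ⟨n, fun i => LinearMap.toSpanSingleton A N x ∘ₗ q i, fun i => p i 1, ?_⟩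
  have := congrArg (LinearMap.toSpanSingleton A N x) (h 1)
  simpa [map_sum] using this

theorem InAdd.eq_of_comp_eq (hgen : InAdd A G A) {M N : Type} [AddCommGroup M] [Module A M]
    [AddCommGroup N] [Module A N] {f g : M →ₗ[A] N}
    (h : ∀ (u : G →ₗ[A] M) (y : G), f (u y) = g (u y)) : f = g := by
  ext x
  obtain ⟨n, q, y, rfl⟩ := hgen.exists_sum_eq x
  simp [map_sum, h]

/-- Lifting along `f` of maps from `G` that are killed by `f'` extends to maps from `add G`. -/
theorem InAdd.exists_lift {Y L M N : Type} [AddCommGroup Y] [Module A Y] [AddCommGroup L]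
    [Module A L] [AddCommGroup M] [Module A M] [AddCommGroup N] [Module A N] (hY : InAdd A G Y)
    (f : L →ₗ[A] M) (f' : M →ₗ[A] N)
    (h : ∀ g : G →ₗ[A] M, (∀ y, f' (g y) = 0) → ∃ u : G →ₗ[A] L, ∀ y, f (u y) = g y)
    (g : Y →ₗ[A] M) (hg : ∀ y, f' (g y) = 0) : ∃ u : Y →ₗ[A] L, ∀ y, f (u y) = g y := by
  obtain ⟨n, p, q, hpq⟩ := hY.exists_decomposition
  choose u hu using fun i => h (g ∘ₗ q i) fun y => hg _
  refine ⟨∑ i, u i ∘ₗ p i, fun y => ?_⟩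
  conv_rhs => rw [← hpq y]
  simp [map_sum, hu]

end AddCategory

section HomFunctor

variable {A : Type} [Ring A] {G : Type} [AddCommGroup G] [Module A G]

variable (G) in
/-- The functor `Hom_A(G, -)` on morphisms. -/
def homMap {M N : Type} [AddCommGroup M] [Module A M] [AddCommGroup N] [Module A N]
    (h : M →ₗ[A] N) : (G →ₗ[A] M) →ₗ[EndOp A G] (G →ₗ[A] N) where
  toFun g := h ∘ₗ g
  map_add' f g := by ext; simp
  map_smul' a g := rfl

@[simp]
theorem homMap_apply_apply {M N : Type} [AddCommGroup M] [Module A M] [AddCommGroup N] [Module A N]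
    (h : M →ₗ[A] N) (g : G →ₗ[A] M) (y : G) : homMap G h g y = h (g y) := rfl

/-- `Hom_A(G, -)` is full on maps out of `add G`. -/
theorem InAdd.exists_homMap_eq {M N : Type} [AddCommGroup M] [Module A M] [AddCommGroup N]
    [Module A N] (hM : InAdd A G M) (φ : (G →ₗ[A] M) →ₗ[EndOp A G] (G →ₗ[A] N)) :
    ∃ h : M →ₗ[A] N, homMap G h = φ := by
  obtain ⟨n, p, q, hpq⟩ := hM.exists_decomposition
  refine ⟨∑ i, φ (q i) ∘ₗ p i, ?_⟩
  ext g y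
  have hg : g = ∑ i, (MulOpposite.op (p i ∘ₗ g) : EndOp A G) • q i := by
    ext y
    rw [LinearMap.sum_apply]
    exact (hpq (g y)).symm
  conv_rhs => rw [hg, map_sum]
  simp only [map_smul, homMap_apply_apply, LinearMap.sum_apply]
  rfl

theorem InAdd.homMap_injective (hgen : InAdd A G A) {M N : Type} [AddCommGroup M] [Module A M]
    [AddCommGroup N] [Module A N] {f g : M →ₗ[A] N} (h : homMap G f = homMap G g) : f = g :=
  hgen.eq_of_comp_eq fun u y => LinearMap.congr_fun (LinearMap.congr_fun h u) y

/-- `Hom_A(G, M)` is a retract of a finite free module for `M` in `add G`. -/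
theorem InAdd.exists_hom_retract {M : Type} [AddCommGroup M] [Module A M] (hM : InAdd A G M) :
    ∃ (n : ℕ) (s : (G →ₗ[A] M) →ₗ[EndOp A G] (Fin n → EndOp A G))
      (r : (Fin n → EndOp A G) →ₗ[EndOp A G] (G →ₗ[A] M)), r ∘ₗ s = LinearMap.id := by
  obtain ⟨n, p, q, hpq⟩ := hM.exists_decomposition
  refine ⟨n,
    { toFun := fun g i => MulOpposite.op (p i ∘ₗ g)
      map_add' := fun f g => by
        funext i
        apply MulOpposite.unop_injective
        ext y
        simp
      map_smul' := fun a g => rfl },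
    Fintype.linearCombination (EndOp A G) q, ?_⟩
  ext g y
  simp only [LinearMap.comp_apply, Fintype.linearCombination_apply, LinearMap.sum_apply,
    LinearMap.id_apply]
  exact hpq (g y)

theorem InAdd.hom_projective {M : Type} [AddCommGroup M] [Module A M] (hM : InAdd A G M) :
    Module.Projective (EndOp A G) (G →ₗ[A] M) := by
  obtain ⟨n, s, r, h⟩ := hM.exists_hom_retract
  exact Module.Projective.of_split s r h

theorem InAdd.hom_finite {M : Type} [AddCommGroup M] [Module A M] (hM : InAdd A G M) :
    Module.Finite (EndOp A G) (G →ₗ[A] M) := by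
  obtain ⟨n, s, r, h⟩ := hM.exists_hom_retract
  exact Module.Finite.of_surjective r fun x => ⟨s x, LinearMap.congr_fun h x⟩

variable (A G) in
/-- The evaluation of tuples of endomorphisms as maps into a power of `G`. -/
def piEndOpEquiv (n : ℕ) : (Fin n → EndOp A G) ≃ₗ[EndOp A G] (G →ₗ[A] (Fin n → G)) where
  toFun c := LinearMap.pi fun i => (c i).unop
  map_add' _ _ := rfl
  map_smul' _ _ := rfl
  invFun g i := MulOpposite.op (LinearMap.proj i ∘ₗ g)
  left_inv _ := rfl
  right_inv _ := rfl

/-- Every finitely generated projective module over `Λ` is `Hom_A(G, X)` with `X` in `add G`. -/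
theorem exists_equiv_hom_of_projective (hgen : InAdd A G A) (P : Type) [AddCommGroup P]
    [Module (EndOp A G) P] [Module.Finite (EndOp A G) P] [Module.Projective (EndOp A G) P] :
    ∃ X : ModOver A, InAdd A G X.carrier ∧ Nonempty (P ≃ₗ[EndOp A G] (G →ₗ[A] X.carrier)) := by
  obtain ⟨n, r₀, hr₀⟩ := Module.Finite.exists_fin' (EndOp A G) P
  obtain ⟨s₀, hs₀⟩ := Module.projective_lifting_property r₀ LinearMap.id hr₀
  let s := (piEndOpEquiv A G n).toLinearMap ∘ₗ s₀
  let r := r₀ ∘ₗ (piEndOpEquiv A G n).symm.toLinearMap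
  have hrs : ∀ x, r (s x) = x := fun x => by
    simpa [r, s] using LinearMap.congr_fun hs₀ x
  obtain ⟨e, he⟩ := (InAdd.pi (A := A) (G := G) n).exists_homMap_eq (s ∘ₗ r)
  have he' : ∀ g y, e (g y) = s (r g) y := fun g y =>
    LinearMap.congr_fun (LinearMap.congr_fun he g) y
  have hee : e ∘ₗ e = e := hgen.homMap_injective <| by
    ext1 g
    ext1 y
    change e (e (g y)) = e (g y)
    rw [he', he', hrs]
  have hee' : ∀ x, e (e x) = e x := LinearMap.congr_fun hee
  refine ⟨⟨LinearMap.range e⟩, (InAdd.pi n).of_retract (LinearMap.range e).subtype e.rangeRestrict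
    ?_, ⟨LinearEquiv.ofLinearMap ?_ (r ∘ₗ homMap G (LinearMap.range e).subtype) ?_ ?_⟩⟩
  · rintro ⟨_, x, rfl⟩
    exact Subtype.ext (hee' x)
  · exact homMap G e.rangeRestrict ∘ₗ s
  · refine LinearMap.ext fun g => LinearMap.ext fun y => Subtype.ext ?_
    change e (s (r (homMap G (LinearMap.range e).subtype g)) y) = (g y : Fin n → G)
    rw [← he']
    obtain ⟨x, hx⟩ := (g y).2
    change e (e (g y)) = _
    rw [hee', ← hx, hee']
  · ext x
    change r (homMap G (LinearMap.range e).subtype (homMap G e.rangeRestrict (s x))) = x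
    have : homMap G (LinearMap.range e).subtype (homMap G e.rangeRestrict (s x)) = s x := by
      ext1 y
      change e (s x y) = s x y
      rw [he', hrs]
    rw [this, hrs]

end HomFunctor

section ProjectiveDimension

variable {R : Type} [Ring R]

theorem PdLE.zero {N : Type} [AddCommGroup N] [Module R N] [Module.Finite R N]
    [Module.Projective R N] : PdLE R N 0 := by
  refine ⟨fun i => Nat.casesOn i ⟨N⟩ fun _ => ⟨PUnit⟩, fun i => 0, LinearMap.id, ?_, ?_, ?_, ?_, ?_,
    ?_⟩
  · rintro (_ | i) <;> dsimp only <;> infer_instance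
  · rintro (_ | i) <;> dsimp only <;> infer_instance
  · exact Function.surjective_id
  · simp
  · intro i
    ext x
    exact iff_of_true ⟨0, rfl⟩ rfl
  · rintro (_ | i) hi x
    · omega
    · rfl

theorem PdLE.succ {K P N : Type} [AddCommGroup K] [Module R K] [AddCommGroup P] [Module R P]
    [AddCommGroup N] [Module R N] [Module.Finite R P] [Module.Projective R P] {n : ℕ}
    (hK : PdLE R K n) (f : K →ₗ[R] P) (g : P →ₗ[R] N) (hf : Function.Injective f)
    (hfg : LinearMap.range f = LinearMap.ker g) (hg : Function.Surjective g) :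
    PdLE R N (n + 1) := by
  obtain ⟨X, d, d₀, hfin, hproj, hsurj, h₀, h, hn⟩ := hK
  refine ⟨fun i => Nat.casesOn i ⟨P⟩ X, fun i => Nat.casesOn i (f ∘ₗ d₀) d, g, ?_, ?_, hg, ?_, ?_,
    ?_⟩
  · rintro (_ | i)
    · assumption
    · exact hfin i
  · rintro (_ | i)
    · assumption
    · exact hproj i
  · change LinearMap.range (f ∘ₗ d₀) = _
    rw [LinearMap.range_comp_of_range_eq_top _ (LinearMap.range_eq_top.2 hsurj), hfg]
  · rintro (_ | i)
    · change LinearMap.range (d 0) = LinearMap.ker (f ∘ₗ d₀)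
      rw [LinearMap.ker_comp_of_ker_eq_bot _ (LinearMap.ker_eq_bot.2 hf), h₀]
    · exact h i
  · rintro (_ | i) hi x
    · omega
    · exact hn i (by omega) x

theorem PdLE.moduleProjective {N : Type} [AddCommGroup N] [Module R N] (h : PdLE R N 0) :
    Module.Projective R N := by
  obtain ⟨X, d, d₀, hfin, hproj, hsurj, h₀, h, hn⟩ := h
  have := hproj 0
  have hker : LinearMap.ker d₀ = ⊥ := by
    rw [← h₀, LinearMap.range_eq_bot]
    ext x
    rw [hn 1 one_pos x, map_zero, map_zero]
  exact Module.Projective.of_equiv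
    (LinearEquiv.ofBijective d₀ ⟨LinearMap.ker_eq_bot.1 hker, hsurj⟩)

theorem PdLE.exists_syzygy {N : Type} [AddCommGroup N] [Module R N] {n : ℕ}
    (h : PdLE R N (n + 1)) :
    ∃ (P : ModOver R) (g : P.carrier →ₗ[R] N), Module.Projective R P.carrier ∧
      Function.Surjective g ∧ PdLE R (LinearMap.ker g) n := by
  obtain ⟨X, d, d₀, hfin, hproj, hsurj, h₀, h, hn⟩ := h
  refine ⟨X 0, d₀, hproj 0, hsurj, fun i => X (i + 1), fun i => d (i + 1),
    (d 0).codRestrict _ fun x => h₀ ▸ LinearMap.mem_range_self _ x, fun i => hfin _,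
    fun i => hproj _, ?_, ?_, fun i => h _, fun i hi => hn _ (by omega)⟩
  · rintro ⟨x, hx⟩
    rw [← h₀] at hx
    obtain ⟨y, rfl⟩ := hx
    exact ⟨y, rfl⟩
  · rw [LinearMap.ker_codRestrict, h]

open CategoryTheory in
theorem PdLE.hasProjectiveDimensionLE {N : Type} [AddCommGroup N] [Module R N] {n : ℕ}
    (h : PdLE R N n) : HasProjectiveDimensionLE (ModuleCat.of R N) n := by
  induction n generalizing N with
  | zero =>
    have := h.moduleProjective
    rw [← projective_iff_hasProjectiveDimensionLE_zero]
    exact (IsProjective.iff_projective N).1 this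
  | succ n ih =>
    obtain ⟨P, g, hP, hg, hK⟩ := h.exists_syzygy
    have : Projective g.shortComplexKer.X₂ := (IsProjective.iff_projective P.carrier).1 hP
    exact ((LinearMap.shortExact_shortComplexKer hg).hasProjectiveDimensionLT_X₃_iff n this).2
      (ih hK)

open CategoryTheory in
theorem PdLE.of_hasProjectiveDimensionLE [IsNoetherianRing R] {N : Type} [AddCommGroup N]
    [Module R N] [Module.Finite R N] {n : ℕ}
    (h : HasProjectiveDimensionLE (ModuleCat.of R N) n) : PdLE R N n := by
  induction n generalizing N with
  | zero =>
    rw [← projective_iff_hasProjectiveDimensionLE_zero] at h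
    have := (IsProjective.iff_projective N).2 h
    exact PdLE.zero
  | succ n ih =>
    obtain ⟨m, g, hg⟩ := Module.Finite.exists_fin' R N
    have : Projective g.shortComplexKer.X₂ :=
      (IsProjective.iff_projective (Fin m → R)).1 inferInstance
    have hK : HasProjectiveDimensionLE (ModuleCat.of R (LinearMap.ker g)) n :=
      ((LinearMap.shortExact_shortComplexKer hg).hasProjectiveDimensionLT_X₃_iff n this).1 h
    exact (ih hK).succ (LinearMap.ker g).subtype g Subtype.val_injective (by simp) hg

open CategoryTheory in
theorem PdLE.syzygy [IsNoetherianRing R] {P N : Type} [AddCommGroup P] [Module R P]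
    [AddCommGroup N] [Module R N] [Module.Finite R P] [Module.Projective R P] {n : ℕ}
    (h : PdLE R N (n + 1)) (g : P →ₗ[R] N) (hg : Function.Surjective g) :
    PdLE R (LinearMap.ker g) n := by
  have : Projective g.shortComplexKer.X₂ := (IsProjective.iff_projective P).1 inferInstance
  exact .of_hasProjectiveDimensionLE
    (((LinearMap.shortExact_shortComplexKer hg).hasProjectiveDimensionLT_X₃_iff n this).1
      h.hasProjectiveDimensionLE)

theorem PdLE.of_equiv {M N : Type} [AddCommGroup M] [Module R M] [AddCommGroup N] [Module R N]
    {n : ℕ} (h : PdLE R M n) (e : M ≃ₗ[R] N) : PdLE R N n := by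
  obtain ⟨X, d, d₀, hfin, hproj, hsurj, h₀, h, hn⟩ := h
  refine ⟨X, d, e.toLinearMap ∘ₗ d₀, hfin, hproj, e.surjective.comp hsurj, ?_, h, hn⟩
  rw [LinearEquiv.ker_comp, h₀]

end ProjectiveDimension

section Resolutions

variable {A : Type} [Ring A] {G : Type} [AddCommGroup G] [Module A G]

theorem IRdimLE.pdLE_hom {M : Type} [AddCommGroup M] [Module A M] {n : ℕ}
    (h : IRdimLE A G M n) : PdLE (EndOp A G) (G →ₗ[A] M) n := by
  obtain ⟨X, f, f₀, ⟨⟨hX₀, happ⟩, hX, h₀, hc, he₀, he⟩, hn⟩ := h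
  have hX' : ∀ i, InAdd A G (X i).carrier := fun i => Nat.casesOn i hX₀ hX
  refine ⟨fun i => ⟨G →ₗ[A] (X i).carrier⟩, fun i => homMap G (f i), homMap G f₀,
    fun i => (hX' i).hom_finite, fun i => (hX' i).hom_projective, fun g => happ G .self g, ?_, ?_,
    fun i hi g => LinearMap.ext fun y => hn i hi _⟩
  · ext g
    constructor
    · rintro ⟨u, rfl⟩
      exact LinearMap.ext fun y => h₀ _
    · intro hg
      obtain ⟨u, hu⟩ := he₀ G .self g fun y => LinearMap.congr_fun hg y
      exact ⟨u, LinearMap.ext hu⟩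
  · intro i
    ext g
    constructor
    · rintro ⟨u, rfl⟩
      exact LinearMap.ext fun y => hc i _
    · intro hg
      obtain ⟨u, hu⟩ := he i G .self g fun y => LinearMap.congr_fun hg y
      exact ⟨u, LinearMap.ext hu⟩

theorem IRdimLE.of_pdLE_hom (hgen : InAdd A G A) {M : Type} [AddCommGroup M] [Module A M] {n : ℕ}
    (h : PdLE (EndOp A G) (G →ₗ[A] M) n) : IRdimLE A G M n := by
  obtain ⟨P, d, d₀, hfin, hproj, hsurj, h₀, h, hn⟩ := h
  choose X hX e using fun i => exists_equiv_hom_of_projective hgen (P i).carrier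
  replace e := fun i => (e i).some
  choose f hf using fun i => (hX (i + 1)).exists_homMap_eq
    ((e i).toLinearMap ∘ₗ d i ∘ₗ (e (i + 1)).symm.toLinearMap)
  obtain ⟨f₀, hf₀⟩ := (hX 0).exists_homMap_eq (d₀ ∘ₗ (e 0).symm.toLinearMap)
  have hf' : ∀ i g, homMap G (f i) g = e i (d i ((e (i + 1)).symm g)) := fun i g => by
    rw [hf i]; rfl
  have hf₀' : ∀ g, homMap G f₀ g = d₀ ((e 0).symm g) := fun g => by rw [hf₀]; rfl
  have hc₀ : ∀ x, d₀ (d 0 x) = 0 := fun x =>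
    LinearMap.mem_ker.1 (h₀ ▸ LinearMap.mem_range_self _ x)
  have hc : ∀ i x, d i (d (i + 1) x) = 0 := fun i x =>
    LinearMap.mem_ker.1 (h i ▸ LinearMap.mem_range_self _ x)
  refine ⟨X, f, f₀, ⟨⟨hX 0, fun Y _ _ hY g => ?_⟩, fun i => hX _, ?_, fun i => ?_, ?_,
    fun i => ?_⟩, fun i hi x => ?_⟩
  · obtain ⟨u, hu⟩ := hY.exists_lift f₀ (0 : M →ₗ[A] M) (fun g _ => by
      obtain ⟨p, hp⟩ := hsurj g
      refine ⟨e 0 p, fun y => ?_⟩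
      rw [← homMap_apply_apply, hf₀', LinearEquiv.symm_apply_apply, hp]) g fun y => rfl
    exact ⟨u, LinearMap.ext hu⟩
  · refine LinearMap.congr_fun (f := f₀ ∘ₗ f 0) (g := 0) (hgen.eq_of_comp_eq fun u y => ?_)
    change homMap G f₀ (homMap G (f 0) u) y = 0
    rw [hf', hf₀', LinearEquiv.symm_apply_apply, hc₀, LinearMap.zero_apply]
  · refine LinearMap.congr_fun (f := f i ∘ₗ f (i + 1)) (g := 0) (hgen.eq_of_comp_eq fun u y => ?_)
    change homMap G (f i) (homMap G (f (i + 1)) u) y = 0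
    rw [hf', hf', LinearEquiv.symm_apply_apply, hc, map_zero, LinearMap.zero_apply]
  · intro Y _ _ hY
    refine hY.exists_lift (f 0) f₀ fun g hg => ?_
    have hg' : (e 0).symm g ∈ LinearMap.ker d₀ := by
      rw [LinearMap.mem_ker, ← hf₀']
      exact LinearMap.ext hg
    rw [← h₀] at hg'
    obtain ⟨p, hp⟩ := hg'
    refine ⟨e 1 p, fun y => ?_⟩
    rw [← homMap_apply_apply, hf', LinearEquiv.symm_apply_apply, hp, LinearEquiv.apply_symm_apply]
  · intro Y _ _ hY
    refine hY.exists_lift (f (i + 1)) (f i) fun g hg => ?_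
    have hg' : (e (i + 1)).symm g ∈ LinearMap.ker (d i) := by
      rw [LinearMap.mem_ker, ← (e i).map_eq_zero_iff, ← hf']
      exact LinearMap.ext hg
    rw [← h] at hg'
    obtain ⟨p, hp⟩ := hg'
    refine ⟨e (i + 2) p, fun y => ?_⟩
    rw [← homMap_apply_apply, hf', LinearEquiv.symm_apply_apply, hp, LinearEquiv.apply_symm_apply]
  · refine LinearMap.congr_fun (f := LinearMap.id) (g := 0) (hgen.eq_of_comp_eq fun u y => ?_) x
    have hu : u = 0 := (e i).symm.map_eq_zero_iff.1 (hn i hi _)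
    rw [hu]
    rfl

end Resolutions

section Injective

/-- The `A`-module of `k`-linear maps from `A` to a vector space `M`. -/
def Coinduced (k A M : Type) [Field k] [Ring A] [Algebra k A] [AddCommGroup M] [Module k M] :
    Type :=
  A →ₗ[k] M

namespace Coinduced

variable {k A M : Type} [Field k] [Ring A] [Algebra k A] [AddCommGroup M] [Module k M]

instance : AddCommGroup (Coinduced k A M) := inferInstanceAs (AddCommGroup (A →ₗ[k] M))

instance : Module k (Coinduced k A M) := inferInstanceAs (Module k (A →ₗ[k] M))

/-- Evaluation of an element of the coinduced module. -/
def eval (φ : Coinduced k A M) : A →ₗ[k] M := φ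

theorem ext {φ ψ : Coinduced k A M} (h : ∀ x, φ.eval x = ψ.eval x) : φ = ψ := LinearMap.ext h

instance : SMul A (Coinduced k A M) where
  smul a φ := φ.eval ∘ₗ LinearMap.mulRight k a

theorem eval_smul (a : A) (φ : Coinduced k A M) (x : A) : (a • φ).eval x = φ.eval (x * a) := rfl

theorem eval_add (φ ψ : Coinduced k A M) (x : A) : (φ + ψ).eval x = φ.eval x + ψ.eval x := rfl

theorem eval_smul_field (c : k) (φ : Coinduced k A M) (x : A) :
    (c • φ).eval x = c • φ.eval x := rfl

instance : Module A (Coinduced k A M) where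
  one_smul φ := ext fun x => by rw [eval_smul, mul_one]
  mul_smul a b φ := ext fun x => by rw [eval_smul, eval_smul, eval_smul, mul_assoc]
  smul_zero a := rfl
  smul_add a φ ψ := rfl
  add_smul a b φ := ext fun x => by
    rw [eval_smul, mul_add, map_add, eval_add, eval_smul, eval_smul]
  zero_smul φ := ext fun x => by
    rw [eval_smul, mul_zero, map_zero]; rfl

instance : IsScalarTower k A (Coinduced k A M) where
  smul_assoc c a φ := ext fun x => by
    rw [eval_smul, eval_smul_field, eval_smul, mul_smul_comm, map_smul]

instance [Module.Finite k A] [Module.Finite k M] : Module.Finite k (Coinduced k A M) :=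
  inferInstanceAs (Module.Finite k (A →ₗ[k] M))

instance injective : Module.Injective A (Coinduced k A M) where
  out X Y _ _ _ _ f hf g := by
    let _ : Module k X := Module.compHom X (algebraMap k A)
    let _ : Module k Y := Module.compHom Y (algebraMap k A)
    have : IsScalarTower k A X := ⟨fun c a x => by
      rw [Algebra.smul_def, mul_smul]; rfl⟩
    have : IsScalarTower k A Y := ⟨fun c a x => by
      rw [Algebra.smul_def, mul_smul]; rfl⟩
    obtain ⟨l, hl⟩ := LinearMap.exists_leftInverse_of_injective (f.restrictScalars k)
      (LinearMap.ker_eq_bot.2 hf)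
    let t : X →ₗ[k] M :=
      { toFun := fun x => (g x).eval 1
        map_add' := fun x y => by rw [map_add, eval_add]
        map_smul' := fun c x => by
          rw [← algebraMap_smul A c x, map_smul, algebraMap_smul, eval_smul_field]; rfl }
    refine ⟨
      { toFun := fun y => (t ∘ₗ l) ∘ₗ (LinearMap.toSpanSingleton A Y y).restrictScalars k
        map_add' := fun y z => ext fun a => ?_
        map_smul' := fun b y => ext fun a => ?_ }, fun x => ext fun a => ?_⟩
    · change t (l (a • (y + z))) = t (l (a • y)) + t (l (a • z))
      rw [smul_add, map_add, map_add]
    · change t (l (a • b • y)) = t (l ((a * b) • y))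
      rw [mul_smul]
    · change t (l (a • f x)) = (g x).eval a
      have : l (f (a • x)) = a • x := LinearMap.congr_fun hl (a • x)
      rw [← map_smul, this]
      change (g (a • x)).eval 1 = _
      rw [map_smul, eval_smul, one_mul]

variable (k A M) in
/-- The embedding of an `A`-module in the module coinduced from its underlying vector space. -/
def unit [Module A M] [IsScalarTower k A M] : M →ₗ[A] Coinduced k A M where
  toFun m := (LinearMap.toSpanSingleton A M m).restrictScalars k
  map_add' x y := ext fun a => smul_add a x y
  map_smul' b x := ext fun a => (mul_smul a b x).symm

theorem unit_injective [Module A M] [IsScalarTower k A M] :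
    Function.Injective (unit k A M) := fun x y h => by
  have : (1 : A) • x = (1 : A) • y := congrArg (fun φ => eval φ 1) h
  simpa using this

end Coinduced

theorem Module.Injective.of_retract {A : Type} [Ring A] {M N : Type} [AddCommGroup M] [Module A M]
    [AddCommGroup N] [Module A N] (hM : Module.Injective A M) (s : N →ₗ[A] M) (r : M →ₗ[A] N)
    (h : ∀ x, r (s x) = x) : Module.Injective A N where
  out X Y _ _ _ _ f hf g := by
    obtain ⟨u, hu⟩ := hM.out f hf (s ∘ₗ g)
    exact ⟨r ∘ₗ u, fun x => by rw [LinearMap.comp_apply, hu, LinearMap.comp_apply, h]⟩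

variable {k A : Type} [Field k] [Ring A] [Algebra k A] {G : Type} [AddCommGroup G] [Module A G]

/-- A finite-dimensional injective module is in `add G` if the indecomposable ones are. -/
theorem InAdd.of_injective
    (hcogen : ∀ (N : Type) [AddCommGroup N] [Module A N], Module.Finite A N →
        IsIndecomposable A N → Module.Injective A N → InAdd A G N)
    (N : Type) [AddCommGroup N] [Module A N] [Module k N] [IsScalarTower k A N]
    [Module.Finite k N] (hN : Module.Injective A N) : InAdd A G N := by
  induction hd : Module.finrank k N using Nat.strong_induction_on generalizing N with
  | _ d ih =>
  by_cases h₀ : ∀ x : N, x = 0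
  · exact .of_forall_eq_zero h₀
  by_cases hi : IsIndecomposable A N
  · exact hcogen N (Module.Finite.of_restrictScalars_finite k A N) hi hN
  push Not at h₀
  rw [IsIndecomposable, not_and] at hi
  have hi' := hi h₀
  push Not at hi'
  obtain ⟨e, hee, he₀, he₁⟩ := hi'
  have hee' : ∀ x, e (e x) = e x := LinearMap.congr_fun hee
  have hlt : ∀ S : Submodule A N, S ≠ ⊤ → Module.finrank k S < d := fun S hS => by
    rw [← hd]
    exact Submodule.finrank_lt (s := S.restrictScalars k) (by simpa using hS)
  let c : N →ₗ[A] N := LinearMap.id - e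
  have hc : ∀ x, c x = x - e x := fun x => rfl
  have hcc : ∀ x, c (c x) = c x := fun x => by simp [hc, hee']
  have key : ∀ u : N →ₗ[A] N, (∀ x, u (u x) = u x) → LinearMap.range u ≠ ⊤ →
      InAdd A G (LinearMap.range u) := fun u hu hne => by
    have : Module.Finite k (LinearMap.range u) :=
      inferInstanceAs (Module.Finite k ((LinearMap.range u).restrictScalars k))
    refine ih _ (hlt _ hne) (LinearMap.range u) (hN.of_retract (LinearMap.range u).subtype
      u.rangeRestrict ?_) rfl
    rintro ⟨_, x, rfl⟩
    exact Subtype.ext (hu x)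
  refine ((key e hee' ?_).prod (key c hcc ?_)).of_retract
    (e.rangeRestrict.prod c.rangeRestrict)
    ((LinearMap.range e).subtype.coprod (LinearMap.range c).subtype) ?_
  · intro htop
    refine he₁ (LinearMap.ext fun x => ?_)
    obtain ⟨y, rfl⟩ := LinearMap.range_eq_top.1 htop x
    exact hee' y
  · intro htop
    refine he₀ (LinearMap.ext fun x => ?_)
    obtain ⟨y, rfl⟩ := LinearMap.range_eq_top.1 htop x
    simp [hc, hee']
  · intro x
    simp [hc]

/-- Every finite-dimensional module embeds in a module in `add G` when `G` is a cogenerator. -/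
theorem exists_injective_inAdd (k : Type) [Field k] [Algebra k A] [Module.Finite k A]
    (hcogen : ∀ (N : Type) [AddCommGroup N] [Module A N], Module.Finite A N →
        IsIndecomposable A N → Module.Injective A N → InAdd A G N)
    (M : Type) [AddCommGroup M] [Module A M] [Module.Finite A M] :
    ∃ (X : ModOver A) (f : M →ₗ[A] X.carrier), InAdd A G X.carrier ∧ Function.Injective f := by
  let _ : Module k M := Module.compHom M (algebraMap k A)
  have : IsScalarTower k A M := ⟨fun c a x => by rw [Algebra.smul_def, mul_smul]; rfl⟩
  have : Module.Finite k M := Module.Finite.trans A M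
  exact ⟨⟨Coinduced k A M⟩, Coinduced.unit k A M,
    InAdd.of_injective (k := k) hcogen _ Coinduced.injective, Coinduced.unit_injective⟩

end Injective

theorem isNoetherianRing_endOp (k : Type) [Field k] (A : Type) [Ring A] [Algebra k A]
    [FiniteDimensional k A] (G : Type) [AddCommGroup G] [Module A G] [Module.Finite A G] :
    IsNoetherianRing (EndOp A G) := by
  let _ : Module k G := Module.compHom G (algebraMap k A)
  have : IsScalarTower k A G := ⟨fun c a x => by rw [Algebra.smul_def, mul_smul]; rfl⟩
  have : Module.Finite k G := Module.Finite.trans A G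
  have : SMulCommClass A k G := IsScalarTower.to_smulCommClass'
  have : Module.Finite k (Module.End A G) :=
    Module.Finite.of_injective (LinearMap.restrictScalarsₗ k A G G k)
      (LinearMap.restrictScalars_injective k)
  have : Module.Finite k (EndOp A G) :=
    Module.Finite.equiv (MulOpposite.opLinearEquiv k : Module.End A G ≃ₗ[k] _)
  exact IsNoetherianRing.of_finite k _

/-- `Hom_A(G, -)` preserves kernels. -/
noncomputable def homKerEquiv {A : Type} [Ring A] (G : Type) [AddCommGroup G] [Module A G]
    {K M N : Type} [AddCommGroup K] [Module A K] [AddCommGroup M] [Module A M] [AddCommGroup N]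
    [Module A N] (i : K →ₗ[A] M) (h : M →ₗ[A] N) (hi : Function.Injective i)
    (hih : LinearMap.range i = LinearMap.ker h) :
    (G →ₗ[A] K) ≃ₗ[EndOp A G] LinearMap.ker (homMap G h) := by
  have hz : ∀ x, h (i x) = 0 := fun x =>
    LinearMap.mem_ker.1 (hih ▸ LinearMap.mem_range_self _ x)
  refine LinearEquiv.ofBijective ((homMap G i).codRestrict _ fun g => LinearMap.ext fun y => hz _)
    ⟨fun f g hfg => LinearMap.ext fun y => hi ?_, fun ⟨g, hg⟩ => ?_⟩
  · exact LinearMap.congr_fun (congrArg Subtype.val hfg) y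
  · have hg' : ∀ y, g y ∈ LinearMap.range i := fun y => by
      rw [hih]
      exact LinearMap.congr_fun hg y
    refine ⟨(LinearEquiv.ofInjective i hi).symm.toLinearMap ∘ₗ g.codRestrict _ hg',
      Subtype.ext (LinearMap.ext fun y => ?_)⟩
    exact congrArg Subtype.val ((LinearEquiv.ofInjective i hi).apply_symm_apply ⟨g y, hg' y⟩)

/-- Let `A` be a finite-dimensional algebra over a field `k`, `G` a module
in `mod A` that is both a generator and a cogenerator (every indecomposable injective
`A`-module lies in `add G` up to isomorphism), `I = add G` and `Λ = End_A(G)`.  Then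
`I`-rgldim `A = gldim Λ − 2`; as an equality of (possibly infinite, truncated-subtraction)
quantities this says that for every `n`, `I`-rgldim `A ≤ n ↔ gldim Λ ≤ n + 2`. -/
theorem iRgldim_eq_gldim_sub_two
    (k : Type) [Field k] (A : Type) [Ring A] [Algebra k A] [FiniteDimensional k A]
    (G : Type) [AddCommGroup G] [Module A G] [Module.Finite A G]
    (hgen : InAdd A G A)
    (hcogen : ∀ (N : Type) [AddCommGroup N] [Module A N], Module.Finite A N →
        IsIndecomposable A N → Module.Injective A N → InAdd A G N) :
    ∀ n : ℕ,
      (∀ (M : Type) [AddCommGroup M] [Module A M], Module.Finite A M → IRdimLE A G M n) ↔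
      GldimLE (EndOp A G) (n + 2) := by
  intro n
  have hΛ : IsNoetherianRing (EndOp A G) := isNoetherianRing_endOp k A G
  have hA : IsNoetherianRing A := IsNoetherianRing.of_finite k A
  constructor
  · intro h N _ _ _
    obtain ⟨m₀, g₀, hg₀⟩ := Module.Finite.exists_fin' (EndOp A G) N
    obtain ⟨m₁, g₁, hg₁⟩ := Module.Finite.exists_fin' (EndOp A G) (LinearMap.ker g₀)
    let φ := (piEndOpEquiv A G m₀).toLinearMap ∘ₗ (LinearMap.ker g₀).subtype ∘ₗ g₁ ∘ₗ
      (piEndOpEquiv A G m₁).symm.toLinearMap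
    obtain ⟨u, hu⟩ := (InAdd.pi (A := A) (G := G) m₁).exists_homMap_eq φ
    have hK := (h (LinearMap.ker u) inferInstance).pdLE_hom.of_equiv (N := LinearMap.ker (homMap G u))
      (homKerEquiv G (LinearMap.ker u).subtype u Subtype.val_injective (by simp))
    have := (InAdd.pi (A := A) (G := G) m₁).hom_finite
    have := (InAdd.pi (A := A) (G := G) m₁).hom_projective
    refine (hK.succ (N := LinearMap.ker g₀) (LinearMap.ker (homMap G u)).subtype
      (g₁ ∘ₗ (piEndOpEquiv A G m₁).symm.toLinearMap) Subtype.val_injective ?_ ?_).succ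
      (LinearMap.ker g₀).subtype g₀ Subtype.val_injective (by simp) hg₀
    · rw [hu, Submodule.range_subtype]
      simp only [φ]
      rw [LinearEquiv.ker_comp, LinearMap.ker_comp_of_ker_eq_bot _ (Submodule.ker_subtype _)]
    · exact hg₁.comp (piEndOpEquiv A G m₁).symm.surjective
  · intro h M _ _ _
    obtain ⟨X₀, f₀, hX₀, hf₀⟩ := exists_injective_inAdd (G := G) k hcogen M
    have := hX₀.moduleFinite
    obtain ⟨X₁, f₁, hX₁, hf₁⟩ :=
      exists_injective_inAdd (G := G) k hcogen (X₀.carrier ⧸ LinearMap.range f₀)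
    let u := f₁ ∘ₗ (LinearMap.range f₀).mkQ
    have hu : LinearMap.range f₀ = LinearMap.ker u := by
      rw [LinearMap.ker_comp_of_ker_eq_bot _ (LinearMap.ker_eq_bot.2 hf₁), Submodule.ker_mkQ]
    refine .of_pdLE_hom hgen (.of_equiv ?_ (homKerEquiv G f₀ u hf₀ hu).symm)
    have := hX₀.hom_finite
    have := hX₀.hom_projective
    have := hX₁.hom_finite
    have := hX₁.hom_projective
    let v := homMap G u
    have h₁ := (h (_ ⧸ LinearMap.range v) inferInstance).syzygy (LinearMap.range v).mkQ
      (Submodule.mkQ_surjective _)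
    rw [Submodule.ker_mkQ] at h₁
    have h₂ := h₁.syzygy v.rangeRestrict v.surjective_rangeRestrict
    rwa [LinearMap.ker_rangeRestrict] at h₂
end
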